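/- Let d ≥ 2. Fix a smooth radial function χ : ℝ^d → ℝ with values in [0,1], supported in the ball B(0,2), equal to 1 on a neighborhood of the closed unit ball B(0,1), and set φ(ξ) = χ(ξ) − χ(2ξ), h = F^{−1}φ, h̃ = F^{−1}χ. For a bounded continuous function g on ℝ^d define the dyadic blocks Δ_{−1} g = h̃ * g and Δ_j g = 2^{jd} h(2^j ·) * g for integers j ≥ 0. Then there exists a constant C > 0, depending only on d and χ, such that for every Schwartz vector field f : ℝ^d → ℝ^d with div f = 0: ‖∇f‖_{L^∞} ≤ C ( ‖f‖_{L²} + Σ_{j ≥ −1} ‖Δ_j (curl f)‖_{L^∞} ), where curl f denotes the matrix-valued function with entries (curl f)_{jk} = ∂_j f_k − ∂_k f_j and the blocks Δ_j act entrywise. -/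

import Mathlib

open MeasureTheory Real
open scoped ENNReal FourierTransform Topology

/-- The partial derivative `∂_k f` of a scalar function on `ℝ^d`. -/
noncomputable def pd {d : ℕ} (f : EuclideanSpace ℝ (Fin d) → ℝ) (k : Fin d)
    (x : EuclideanSpace ℝ (Fin d)) : ℝ :=
  fderiv ℝ f x (EuclideanSpace.single k 1)

/-- The dyadic block with convolution kernel `K` applied to a real-valued function `g`. -/
noncomputable def dblock {d : ℕ} (K : EuclideanSpace ℝ (Fin d) → ℂ)
    (g : EuclideanSpace ℝ (Fin d) → ℝ) (x : EuclideanSpace ℝ (Fin d)) : ℂ :=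
  ∫ y, K y * (g (x - y) : ℂ)

/-- The `(i, i')` entry of the curl matrix `(curl f)_{i i'} = ∂_i f_{i'} − ∂_{i'} f_i`. -/
noncomputable def curlMat {d : ℕ} (f : EuclideanSpace ℝ (Fin d) → Fin d → ℝ)
    (i i' : Fin d) (y : EuclideanSpace ℝ (Fin d)) : ℝ :=
  pd (fun z => f z i') i y - pd (fun z => f z i) i' y

open scoped SchwartzMap LineDeriv

section FourierMultiplier

variable {E : Type*} [NormedAddCommGroup E] [InnerProductSpace ℝ E]

/-- The dilation `ξ ↦ m (c • ξ)` of a Schwartz function. -/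
noncomputable def schwartzDilation (c : ℝˣ) (m : 𝓢(E, ℂ)) : 𝓢(E, ℂ) :=
  SchwartzMap.compCLMOfContinuousLinearEquiv ℂ (ContinuousLinearEquiv.smulLeft c) m

theorem schwartzDilation_apply (c : ℝˣ) (m : 𝓢(E, ℂ)) (ξ : E) :
    schwartzDilation c m ξ = m ((c : ℝ) • ξ) := rfl

variable [FiniteDimensional ℝ E] [MeasurableSpace E] [BorelSpace E]

/-- The Fourier multiplier with Schwartz symbol `m`, acting on Schwartz functions. -/
noncomputable def schwartzMultiplier (m F : 𝓢(E, ℂ)) : 𝓢(E, ℂ) :=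
  SchwartzMap.convolution (ContinuousLinearMap.mul ℂ ℂ) (𝓕⁻ m) F

theorem fourier_schwartzMultiplier (m F : 𝓢(E, ℂ)) (ξ : E) :
    𝓕 (schwartzMultiplier m F) ξ = m ξ * 𝓕 F ξ := by
  simp [schwartzMultiplier, SchwartzMap.fourier_convolution]

theorem schwartzMultiplier_apply (m F : 𝓢(E, ℂ)) (x : E) :
    schwartzMultiplier m F x = ∫ y, 𝓕⁻ m y * F (x - y) := by
  rw [schwartzMultiplier, SchwartzMap.convolution_apply]
  rfl

theorem SchwartzMap.ext_fourier {F G : 𝓢(E, ℂ)} (h : ∀ ξ, 𝓕 F ξ = 𝓕 G ξ) : F = G := by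
  have := congrArg (fun f : 𝓢(E, ℂ) => (𝓕⁻ f : 𝓢(E, ℂ))) (SchwartzMap.ext h : 𝓕 F = 𝓕 G)
  simpa using this

theorem norm_schwartzMultiplier_le_of_bound (m F : 𝓢(E, ℂ)) {B : ℝ} (hB : ∀ x, ‖F x‖ ≤ B)
    (x : E) :
    ‖schwartzMultiplier m F x‖ ≤ (∫ y, ‖𝓕⁻ m y‖) * B := by
  rw [schwartzMultiplier_apply, ← integral_mul_const]
  refine norm_integral_le_of_norm_le ((𝓕⁻ m).integrable.norm.mul_const B) (.of_forall fun y => ?_)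
  rw [norm_mul]
  gcongr
  exact hB _

theorem norm_schwartzMultiplier_le_L2 (m F : 𝓢(E, ℂ)) (x : E) :
    ‖schwartzMultiplier m F x‖ ≤ √(∫ y, ‖𝓕⁻ m y‖ ^ 2) * √(∫ y, ‖F y‖ ^ 2) := by
  rw [schwartzMultiplier_apply]
  have hF : MemLp (fun y => ‖F (x - y)‖) (ENNReal.ofReal 2) volume := by
    have := ((F.memLp (ENNReal.ofReal 2) volume).comp_measurePreserving
      (Measure.measurePreserving_sub_left volume x)).norm
    exact this
  have hm : MemLp (fun y => ‖𝓕⁻ m y‖) (ENNReal.ofReal 2) volume := ((𝓕⁻ m).memLp _ volume).norm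
  have key := integral_mul_le_Lp_mul_Lq_of_nonneg (μ := volume) Real.HolderConjugate.two_two
    (.of_forall fun y => norm_nonneg (𝓕⁻ m y)) (.of_forall fun y => norm_nonneg (F (x - y))) hm hF
  have e : ∫ y, ‖F (x - y)‖ ^ 2 = ∫ y, ‖F y‖ ^ 2 :=
    integral_sub_left_eq_self (fun y => ‖F y‖ ^ 2) volume x
  simp only [Real.rpow_two, ← Real.sqrt_eq_rpow, e] at key
  refine (norm_integral_le_integral_norm _).trans ?_
  simpa only [norm_mul] using key

theorem norm_le_integral_of_norm_fourier_le (H G : 𝓢(E, ℂ)) {c : ℝ}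
    (h : ∀ ξ, ‖𝓕 H ξ‖ ≤ c * ‖ξ‖ * ‖𝓕 G ξ‖) (x : E) :
    ‖H x‖ ≤ c * ∫ ξ, ‖ξ‖ * ‖𝓕 G ξ‖ := by
  have hi : Integrable (fun ξ => ‖ξ‖ * ‖𝓕 G ξ‖) volume := by
    refine ((𝓕 G).integrable_pow_mul volume 1).congr (.of_forall fun ξ => ?_)
    simp only [pow_one]
  have hH : 𝓕⁻ (𝓕 H) = H := FourierTransform.fourierInv_fourier_eq H
  rw [← hH, SchwartzMap.fourierInv_coe, Real.fourierInv_eq, ← integral_const_mul]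
  refine norm_integral_le_of_norm_le (hi.const_mul c) (.of_forall fun ξ => ?_)
  rw [Circle.norm_smul, ← mul_assoc]
  exact h ξ

theorem fourierInv_schwartzDilation (c : ℝˣ) (m : 𝓢(E, ℂ)) (y : E) :
    𝓕⁻ (schwartzDilation c m) y =
      ((|((c : ℝ) ^ Module.finrank ℝ E)⁻¹| : ℝ) : ℂ) * 𝓕⁻ m ((c : ℝ)⁻¹ • y) := by
  simp only [SchwartzMap.fourierInv_coe, Real.fourierInv_eq]
  have := Measure.integral_comp_smul (volume : Measure E)
    (fun v => 𝐞 (inner ℝ v ((c : ℝ)⁻¹ • y)) • m v) (c : ℝ)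
  rw [Complex.real_smul] at this
  rw [← this]
  refine integral_congr_ae (.of_forall fun v => ?_)
  simp [schwartzDilation_apply, real_inner_smul_left, real_inner_smul_right]

theorem integral_norm_fourierInv_schwartzDilation (c : ℝˣ) (m : 𝓢(E, ℂ)) :
    ∫ y, ‖𝓕⁻ (schwartzDilation c m) y‖ = ∫ y, ‖𝓕⁻ m y‖ := by
  simp only [fourierInv_schwartzDilation, norm_mul, integral_const_mul]
  rw [Measure.integral_comp_inv_smul volume (fun y => ‖𝓕⁻ m y‖)]
  have : (c : ℝ) ^ Module.finrank ℝ E ≠ 0 := pow_ne_zero _ c.ne_zero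
  simp only [Complex.norm_real, Real.norm_eq_abs, abs_abs, smul_eq_mul, abs_inv]
  field_simp

end FourierMultiplier

section LittlewoodPaley

variable {d : ℕ}

/-- The complexified `k`-th component of a Schwartz vector field. -/
noncomputable def schwartzComponent (f : 𝓢(EuclideanSpace ℝ (Fin d), Fin d → ℝ)) (k : Fin d) :
    𝓢(EuclideanSpace ℝ (Fin d), ℂ) :=
  f.postcompCLM (Complex.ofRealCLM ∘L ContinuousLinearMap.proj k)

theorem schwartzComponent_apply (f : 𝓢(EuclideanSpace ℝ (Fin d), Fin d → ℝ)) (k : Fin d)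
    (x : EuclideanSpace ℝ (Fin d)) : schwartzComponent f k x = (f x k : ℂ) := rfl

theorem fderiv_single_apply (f : 𝓢(EuclideanSpace ℝ (Fin d), Fin d → ℝ)) (l k : Fin d)
    (x : EuclideanSpace ℝ (Fin d)) :
    fderiv ℝ f x (EuclideanSpace.single l 1) k = pd (fun y => f y k) l x := by
  have h : HasFDerivAt (fun y => f y k)
      ((ContinuousLinearMap.proj k : (Fin d → ℝ) →L[ℝ] ℝ) ∘L fderiv ℝ f x) x :=
    (ContinuousLinearMap.proj k : (Fin d → ℝ) →L[ℝ] ℝ).hasFDerivAt.comp x (f.hasFDerivAt x)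
  rw [pd, h.fderiv]
  rfl

theorem lineDerivOp_schwartzComponent (f : 𝓢(EuclideanSpace ℝ (Fin d), Fin d → ℝ)) (l k : Fin d)
    (x : EuclideanSpace ℝ (Fin d)) :
    (∂_{EuclideanSpace.single l (1 : ℝ)} (schwartzComponent f k) :
      𝓢(EuclideanSpace ℝ (Fin d), ℂ)) x = (pd (fun y => f y k) l x : ℂ) := by
  have h : HasFDerivAt (schwartzComponent f k)
      ((Complex.ofRealCLM ∘L (ContinuousLinearMap.proj k : (Fin d → ℝ) →L[ℝ] ℝ)) ∘L
        fderiv ℝ f x) x :=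
    (Complex.ofRealCLM ∘L (ContinuousLinearMap.proj k : (Fin d → ℝ) →L[ℝ] ℝ)).hasFDerivAt.comp x
      (f.hasFDerivAt x)
  rw [SchwartzMap.lineDerivOp_apply_eq_fderiv, h.fderiv, ← fderiv_single_apply]
  rfl

theorem fourier_lineDerivOp_single (F : 𝓢(EuclideanSpace ℝ (Fin d), ℂ)) (l : Fin d)
    (ξ : EuclideanSpace ℝ (Fin d)) :
    𝓕 (∂_{EuclideanSpace.single l (1 : ℝ)} F : 𝓢(EuclideanSpace ℝ (Fin d), ℂ)) ξ =
      2 * π * Complex.I * ξ l * 𝓕 F ξ := by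
  have h : (inner ℝ · (EuclideanSpace.single l (1 : ℝ)) :
      EuclideanSpace ℝ (Fin d) → ℝ).HasTemperateGrowth := by fun_prop
  rw [SchwartzMap.fourier_lineDerivOp_eq, smul_apply, SchwartzMap.smulLeftCLM_apply_apply h]
  simp [EuclideanSpace.inner_single_right, mul_assoc]

/-- The complexified entry `∂_i f_k - ∂_k f_i` of the curl, as a Schwartz function. -/
noncomputable def schwartzCurl (f : 𝓢(EuclideanSpace ℝ (Fin d), Fin d → ℝ)) (i k : Fin d) :
    𝓢(EuclideanSpace ℝ (Fin d), ℂ) :=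
  ∂_{EuclideanSpace.single i (1 : ℝ)} (schwartzComponent f k) -
    ∂_{EuclideanSpace.single k (1 : ℝ)} (schwartzComponent f i)

theorem schwartzCurl_apply (f : 𝓢(EuclideanSpace ℝ (Fin d), Fin d → ℝ)) (i k : Fin d)
    (x : EuclideanSpace ℝ (Fin d)) :
    schwartzCurl f i k x = (curlMat (fun y => f y) i k x : ℂ) := by
  simp [schwartzCurl, lineDerivOp_schwartzComponent, curlMat]

theorem fourier_schwartzCurl (f : 𝓢(EuclideanSpace ℝ (Fin d), Fin d → ℝ)) (i k : Fin d)
    (ξ : EuclideanSpace ℝ (Fin d)) :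
    𝓕 (schwartzCurl f i k) ξ = 2 * π * Complex.I *
      (ξ i * 𝓕 (schwartzComponent f k) ξ - ξ k * 𝓕 (schwartzComponent f i) ξ) := by
  have h := congrArg (fun G : 𝓢(EuclideanSpace ℝ (Fin d), ℂ) => G ξ)
    ((FourierTransform.fourierCLM ℂ 𝓢(EuclideanSpace ℝ (Fin d), ℂ)).map_sub
      (∂_{EuclideanSpace.single i (1 : ℝ)} (schwartzComponent f k))
      (∂_{EuclideanSpace.single k (1 : ℝ)} (schwartzComponent f i)))
  simp only [FourierTransform.fourierCLM_apply, sub_apply, fourier_lineDerivOp_single] at h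
  rw [schwartzCurl, h]
  ring

theorem sum_mul_fourier_schwartzComponent_eq_zero
    (f : 𝓢(EuclideanSpace ℝ (Fin d), Fin d → ℝ))
    (hf : ∀ x, ∑ k, pd (fun y => f y k) k x = 0) (ξ : EuclideanSpace ℝ (Fin d)) :
    ∑ k, (ξ k : ℂ) * 𝓕 (schwartzComponent f k) ξ = 0 := by
  have h0 : ∑ k, (∂_{EuclideanSpace.single k (1 : ℝ)} (schwartzComponent f k) :
      𝓢(EuclideanSpace ℝ (Fin d), ℂ)) = 0 := by
    ext x
    simp only [sum_apply, lineDerivOp_schwartzComponent, zero_apply]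
    exact_mod_cast hf x
  have h1 := congrArg (fun G : 𝓢(EuclideanSpace ℝ (Fin d), ℂ) =>
    (FourierTransform.fourierCLM ℂ 𝓢(EuclideanSpace ℝ (Fin d), ℂ) G) ξ) h0
  simp only [map_sum, map_zero, sum_apply, zero_apply,
    FourierTransform.fourierCLM_apply, fourier_lineDerivOp_single, mul_assoc] at h1
  simp only [← Finset.mul_sum] at h1
  simpa [Real.pi_ne_zero] using h1

theorem norm_fderiv_le_sum (f : 𝓢(EuclideanSpace ℝ (Fin d), Fin d → ℝ))
    (x : EuclideanSpace ℝ (Fin d)) {B : Fin d → ℝ}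
    (hB : ∀ l k, |pd (fun y => f y k) l x| ≤ B l) :
    ‖fderiv ℝ f x‖ ≤ ∑ l, B l := by
  rcases isEmpty_or_nonempty (Fin d) with hd | hd
  · have : fderiv ℝ f x = 0 := by ext v k; exact hd.elim k
    simp [this]
  have hB0 : ∀ l, 0 ≤ B l := fun l => (abs_nonneg _).trans (hB l (Classical.arbitrary _))
  refine ContinuousLinearMap.opNorm_le_bound _ (Finset.sum_nonneg fun l _ => hB0 l) fun v => ?_
  have hv : v = ∑ l, v l • EuclideanSpace.single l (1 : ℝ) := by
    simpa using ((EuclideanSpace.basisFun (Fin d) ℝ).sum_repr v).symm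
  conv_lhs => rw [hv]
  rw [map_sum, Finset.sum_mul]
  refine (norm_sum_le _ _).trans (Finset.sum_le_sum fun l _ => ?_)
  rw [map_smul, norm_smul, mul_comm]
  refine mul_le_mul ?_ (PiLp.norm_apply_le v l) (norm_nonneg _) (hB0 l)
  refine (pi_norm_le_iff_of_nonneg (hB0 l)).2 fun k => ?_
  rw [fderiv_single_apply, Real.norm_eq_abs]
  exact hB l k

theorem exists_schwartz_eq_mul_div_norm_sq {χ : EuclideanSpace ℝ (Fin d) → ℝ}
    (hχ : ContDiff ℝ (⊤ : ℕ∞) χ) (h0 : ∀ ξ, 2 ≤ ‖ξ‖ → χ ξ = 0) (h1 : ∀ ξ, ‖ξ‖ ≤ 1 → χ ξ = 1)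
    (l m : Fin d) :
    ∃ M : 𝓢(EuclideanSpace ℝ (Fin d), ℂ), ∀ ξ, 1 / 2 ≤ ‖ξ‖ → ‖ξ‖ ≤ 2 →
      M ξ = ((ξ l * ξ m / ‖ξ‖ ^ 2 : ℝ) : ℂ) := by
  set g : EuclideanSpace ℝ (Fin d) → ℝ := fun ξ =>
    (χ ((1 / 2 : ℝ) • ξ) - χ ((4 : ℝ) • ξ)) * (ξ l * ξ m / ‖ξ‖ ^ 2) with hg
  have hnorm : ∀ (c : ℝ) (ξ : EuclideanSpace ℝ (Fin d)), 0 ≤ c → ‖c • ξ‖ = c * ‖ξ‖ := by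
    intro c ξ hc
    rw [norm_smul, Real.norm_of_nonneg hc]
  have hsmooth : ContDiff ℝ (⊤ : ℕ∞) g := by
    rw [contDiff_iff_contDiffAt]
    intro ξ
    rcases eq_or_ne ξ 0 with rfl | hξ
    · have : g =ᶠ[𝓝 0] fun _ => 0 := by
        filter_upwards [Metric.ball_mem_nhds (0 : EuclideanSpace ℝ (Fin d))
          (by norm_num : (0 : ℝ) < 1 / 4)] with ξ hξ
        rw [mem_ball_zero_iff] at hξ
        rw [hg]
        dsimp only
        rw [h1 _ (by rw [hnorm _ _ (by norm_num)]; linarith),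
          h1 _ (by rw [hnorm _ _ (by norm_num)]; linarith), sub_self, zero_mul]
      exact contDiffAt_const.congr_of_eventuallyEq this
    · have hn : ‖ξ‖ ^ 2 ≠ 0 := pow_ne_zero _ (norm_ne_zero_iff.2 hξ)
      have hl : ∀ i : Fin d, ContDiff ℝ (⊤ : ℕ∞) fun ξ : EuclideanSpace ℝ (Fin d) => ξ i :=
        fun i => (EuclideanSpace.proj i : EuclideanSpace ℝ (Fin d) →L[ℝ] ℝ).contDiff
      refine ContDiffAt.mul (ContDiff.contDiffAt ?_) (ContDiffAt.div ?_ ?_ hn)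
      · exact (hχ.comp (contDiff_const_smul _)).sub (hχ.comp (contDiff_const_smul _))
      · exact ((hl l).mul (hl m)).contDiffAt
      · exact (contDiff_norm_sq ℝ).contDiffAt
  have hcomp : HasCompactSupport g := by
    refine HasCompactSupport.intro (isCompact_closedBall (0 : EuclideanSpace ℝ (Fin d)) 4) ?_
    intro ξ hξ
    rw [mem_closedBall_zero_iff, not_le] at hξ
    rw [hg]
    dsimp only
    rw [h0 _ (by rw [hnorm _ _ (by norm_num)]; linarith),
      h0 _ (by rw [hnorm _ _ (by norm_num)]; linarith), sub_self, zero_mul]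
  refine ⟨(hcomp.comp_left (g := Complex.ofReal) Complex.ofReal_zero).toSchwartzMap
    (Complex.ofRealCLM.contDiff.comp hsmooth), fun ξ ha hb => ?_⟩
  change ((g ξ : ℝ) : ℂ) = _
  rw [hg]
  dsimp only
  rw [h1 _ (by rw [hnorm _ _ (by norm_num)]; linarith),
    h0 _ (by rw [hnorm _ _ (by norm_num)]; linarith), sub_zero, one_mul]

/-- The dyadic number `2 ^ (-j)` as a unit. -/
noncomputable def dyadicUnit (j : ℕ) : ℝˣ := Units.mk0 ((2 : ℝ) ^ j)⁻¹ (by positivity)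

theorem coe_dyadicUnit (j : ℕ) : (dyadicUnit j : ℝ) = ((2 : ℝ) ^ j)⁻¹ := rfl

theorem schwartzMultiplier_schwartzCurl_eq_dblock (Φ : 𝓢(EuclideanSpace ℝ (Fin d), ℂ))
    (f : 𝓢(EuclideanSpace ℝ (Fin d), Fin d → ℝ)) (j : ℕ) (i k : Fin d)
    (x : EuclideanSpace ℝ (Fin d)) :
    schwartzMultiplier (schwartzDilation (dyadicUnit j) Φ) (schwartzCurl f i k) x =
      dblock (fun y => (((2 : ℝ) ^ (j * d) : ℝ) : ℂ) * 𝓕⁻ Φ ((2 : ℝ) ^ j • y))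
        (curlMat (fun y => f y) i k) x := by
  rw [schwartzMultiplier_apply, dblock]
  refine integral_congr_ae (.of_forall fun y => ?_)
  simp only [fourierInv_schwartzDilation, schwartzCurl_apply, coe_dyadicUnit, inv_inv,
    finrank_euclideanSpace_fin]
  rw [inv_pow, inv_inv, ← pow_mul, abs_of_nonneg (by positivity)]

theorem schwartzMultiplier_lineDerivOp_eq_sum {Φ : 𝓢(EuclideanSpace ℝ (Fin d), ℂ)}
    (hΦ : ∀ η, Φ η ≠ 0 → 1 / 2 ≤ ‖η‖ ∧ ‖η‖ ≤ 2)
    {l : Fin d} {M : Fin d → 𝓢(EuclideanSpace ℝ (Fin d), ℂ)}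
    (hM : ∀ m ξ, 1 / 2 ≤ ‖ξ‖ → ‖ξ‖ ≤ 2 → M m ξ = ((ξ l * ξ m / ‖ξ‖ ^ 2 : ℝ) : ℂ))
    (f : 𝓢(EuclideanSpace ℝ (Fin d), Fin d → ℝ))
    (hf : ∀ x, ∑ k, pd (fun y => f y k) k x = 0) (k : Fin d) (c : ℝˣ) :
    schwartzMultiplier (schwartzDilation c Φ)
        (∂_{EuclideanSpace.single l (1 : ℝ)} (schwartzComponent f k)) =
      ∑ m, schwartzMultiplier (schwartzDilation c (M m))
        (schwartzMultiplier (schwartzDilation c Φ) (schwartzCurl f m k)) := by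
  refine SchwartzMap.ext_fourier fun ξ => ?_
  have hs := congrArg (fun G : 𝓢(EuclideanSpace ℝ (Fin d), ℂ) => G ξ)
    (map_sum (FourierTransform.fourierCLM ℂ 𝓢(EuclideanSpace ℝ (Fin d), ℂ))
      (fun m => schwartzMultiplier (schwartzDilation c (M m))
        (schwartzMultiplier (schwartzDilation c Φ) (schwartzCurl f m k))) Finset.univ)
  simp only [FourierTransform.fourierCLM_apply, sum_apply, fourier_schwartzMultiplier] at hs
  rw [hs, fourier_schwartzMultiplier, fourier_lineDerivOp_single]
  simp only [schwartzDilation_apply, fourier_schwartzCurl]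
  by_cases h : Φ ((c : ℝ) • ξ) = 0
  · simp [h]
  obtain ⟨ha, hb⟩ := hΦ _ h
  have hdiv := sum_mul_fourier_schwartzComponent_eq_zero f hf ξ
  have hc : ((c : ℝ) : ℂ) ≠ 0 := Complex.ofReal_ne_zero.2 c.ne_zero
  have hξ : ξ ≠ 0 := by
    rintro rfl
    norm_num at ha
  have hn : ((‖ξ‖ : ℝ) : ℂ) ≠ 0 := Complex.ofReal_ne_zero.2 (norm_ne_zero_iff.2 hξ)
  have hsq : ∑ m, (ξ m : ℂ) ^ 2 = (‖ξ‖ : ℂ) ^ 2 := by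
    have := EuclideanSpace.real_norm_sq_eq ξ
    exact_mod_cast this.symm
  have hMc : ∀ m, M m ((c : ℝ) • ξ) = (ξ l : ℂ) * ξ m / (‖ξ‖ : ℂ) ^ 2 := by
    intro m
    rw [hM m _ ha hb, norm_smul, mul_pow, Real.norm_eq_abs, sq_abs]
    simp only [PiLp.smul_apply, smul_eq_mul]
    push_cast
    field_simp
  simp only [hMc]
  set F := fun m => 𝓕 (schwartzComponent f m) ξ with hF
  have e : ∀ m, (ξ l : ℂ) * ξ m / (‖ξ‖ : ℂ) ^ 2 * (Φ ((c : ℝ) • ξ) *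
      (2 * π * Complex.I * (ξ m * F k - ξ k * F m))) =
      (ξ l : ℂ) / (‖ξ‖ : ℂ) ^ 2 * Φ ((c : ℝ) • ξ) * (2 * π * Complex.I) *
        ((ξ m : ℂ) ^ 2 * F k - ξ k * (ξ m * F m)) := fun m => by ring
  change _ * (_ * F k) = ∑ m, (ξ l : ℂ) * ξ m / (‖ξ‖ : ℂ) ^ 2 * (Φ ((c : ℝ) • ξ) *
      (2 * π * Complex.I * (ξ m * F k - ξ k * F m)))
  simp only [e]
  rw [← Finset.mul_sum, Finset.sum_sub_distrib, ← Finset.sum_mul, ← Finset.mul_sum, hsq, hdiv]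
  field_simp
  ring

theorem norm_sub_sum_schwartzMultiplier_le {X Φ : 𝓢(EuclideanSpace ℝ (Fin d), ℂ)}
    (hX1 : ∀ ξ, ‖1 - X ξ‖ ≤ 2 * ‖ξ‖) (hΦ : ∀ ξ, Φ ξ = X ξ - X ((2 : ℝ) • ξ))
    (G : 𝓢(EuclideanSpace ℝ (Fin d), ℂ)) (N : ℕ) (x : EuclideanSpace ℝ (Fin d)) :
    ‖G x - schwartzMultiplier (schwartzDilation (Units.mk0 2 two_ne_zero) X) G x -
        ∑ j ∈ Finset.range N, schwartzMultiplier (schwartzDilation (dyadicUnit j) Φ) G x‖ ≤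
      4 * ((2 : ℝ) ^ N)⁻¹ * ∫ ξ, ‖ξ‖ * ‖𝓕 G ξ‖ := by
  set H : 𝓢(EuclideanSpace ℝ (Fin d), ℂ) :=
    G - schwartzMultiplier (schwartzDilation (Units.mk0 2 two_ne_zero) X) G -
      ∑ j ∈ Finset.range N, schwartzMultiplier (schwartzDilation (dyadicUnit j) Φ) G with hH
  have hx : H x = G x - schwartzMultiplier (schwartzDilation (Units.mk0 2 two_ne_zero) X) G x -
      ∑ j ∈ Finset.range N, schwartzMultiplier (schwartzDilation (dyadicUnit j) Φ) G x := by
    simp [hH]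
  rw [← hx]
  refine norm_le_integral_of_norm_fourier_le H G (fun ξ => ?_) x
  have hs : 𝓕 H ξ = 𝓕 G ξ - X ((2 : ℝ) • ξ) * 𝓕 G ξ -
      ∑ j ∈ Finset.range N, Φ (((2 : ℝ) ^ j)⁻¹ • ξ) * 𝓕 G ξ := by
    have := congrArg (fun K : 𝓢(EuclideanSpace ℝ (Fin d), ℂ) =>
      (FourierTransform.fourierCLM ℂ 𝓢(EuclideanSpace ℝ (Fin d), ℂ) K) ξ) hH
    simpa only [map_sub, map_sum, FourierTransform.fourierCLM_apply, sum_apply, sub_apply,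
      fourier_schwartzMultiplier, schwartzDilation_apply, coe_dyadicUnit, Units.val_mk0] using this
  have ht : ∑ j ∈ Finset.range N, Φ (((2 : ℝ) ^ j)⁻¹ • ξ) =
      X ((2 * ((2 : ℝ) ^ N)⁻¹) • ξ) - X ((2 : ℝ) • ξ) := by
    have := Finset.sum_range_sub (fun j : ℕ => X ((2 * ((2 : ℝ) ^ j)⁻¹) • ξ)) N
    simp only [pow_zero, inv_one, mul_one] at this
    rw [← this]
    refine Finset.sum_congr rfl fun j _ => ?_
    rw [hΦ, smul_smul, pow_succ, mul_inv, mul_comm ((2 : ℝ) ^ j)⁻¹ 2⁻¹, ← mul_assoc,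
      mul_inv_cancel₀ two_ne_zero, one_mul]
  have hs' : 𝓕 H ξ = (1 - X ((2 * ((2 : ℝ) ^ N)⁻¹) • ξ)) * 𝓕 G ξ := by
    rw [hs, ← Finset.sum_mul, ht]
    ring
  rw [hs', norm_mul]
  gcongr
  refine (hX1 _).trans_eq ?_
  rw [norm_smul, Real.norm_of_nonneg (by positivity)]
  ring

theorem norm_schwartzMultiplier_dyadic_le {Φ : 𝓢(EuclideanSpace ℝ (Fin d), ℂ)}
    (hΦ : ∀ ξ, ‖Φ ξ‖ ≤ 4 * ‖ξ‖) (G : 𝓢(EuclideanSpace ℝ (Fin d), ℂ)) (j : ℕ)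
    (x : EuclideanSpace ℝ (Fin d)) :
    ‖schwartzMultiplier (schwartzDilation (dyadicUnit j) Φ) G x‖ ≤
      4 * ((2 : ℝ) ^ j)⁻¹ * ∫ ξ, ‖ξ‖ * ‖𝓕 G ξ‖ := by
  refine norm_le_integral_of_norm_fourier_le _ G (fun ξ => ?_) x
  rw [fourier_schwartzMultiplier, schwartzDilation_apply, coe_dyadicUnit, norm_mul]
  gcongr
  refine (hΦ _).trans_eq ?_
  rw [norm_smul, Real.norm_of_nonneg (by positivity)]
  ring

theorem schwartzMultiplier_lineDerivOp (m F : 𝓢(EuclideanSpace ℝ (Fin d), ℂ)) (l : Fin d) :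
    schwartzMultiplier m (∂_{EuclideanSpace.single l (1 : ℝ)} F) =
      schwartzMultiplier (𝓕 (∂_{EuclideanSpace.single l (1 : ℝ)} (𝓕⁻ m) :
        𝓢(EuclideanSpace ℝ (Fin d), ℂ))) F := by
  refine SchwartzMap.ext_fourier fun ξ => ?_
  rw [fourier_schwartzMultiplier, fourier_schwartzMultiplier, fourier_lineDerivOp_single,
    fourier_lineDerivOp_single, FourierTransform.fourier_fourierInv_eq]
  ring

theorem sqrt_integral_norm_schwartzComponent_sq_le
    (f : 𝓢(EuclideanSpace ℝ (Fin d), Fin d → ℝ)) (k : Fin d) :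
    √(∫ x, ‖schwartzComponent f k x‖ ^ 2) ≤ √(∫ x, ∑ i, f x i ^ 2) := by
  have e : ∀ i x, ‖schwartzComponent f i x‖ ^ 2 = f x i ^ 2 := fun i x => by
    rw [schwartzComponent_apply, Complex.norm_real, Real.norm_eq_abs, sq_abs]
  have hi : ∀ i, Integrable fun x => f x i ^ 2 := fun i => by
    have := ((schwartzComponent f i).memLp 2 volume).integrable_norm_pow two_ne_zero
    simpa only [e] using this
  simp only [e]
  refine Real.sqrt_le_sqrt (integral_mono (hi k) (integrable_finsetSum _ fun i _ => hi i) ?_)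
  intro x
  exact Finset.single_le_sum (f := fun i => f x i ^ 2) (fun i _ => sq_nonneg _) (Finset.mem_univ k)

end LittlewoodPaley

/-- **`‖∇f‖_{L^∞} ≲ ‖f‖_{L²} + ‖curl f‖_{B⁰_{∞,1}}` for divergence-free fields.**
The Besov norm of `curl f` is expressed through the dyadic blocks `Δ_j` built from the
Littlewood–Paley cut-off `χ`. -/
theorem grad_le_L2_add_besov_curl (d : ℕ) (hd : 2 ≤ d)
    (χ : EuclideanSpace ℝ (Fin d) → ℝ)
    (hχ_smooth : ContDiff ℝ (⊤ : ℕ∞) χ)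
    (hχ_radial : ∀ x y : EuclideanSpace ℝ (Fin d), ‖x‖ = ‖y‖ → χ x = χ y)
    (hχ_range : ∀ ξ, χ ξ ∈ Set.Icc (0 : ℝ) 1)
    (hχ_supp : Function.support χ ⊆ Metric.ball 0 2)
    (hχ_one : {ξ | χ ξ = 1} ∈ 𝓝ˢ (Metric.closedBall (0 : EuclideanSpace ℝ (Fin d)) 1))
    (φm : EuclideanSpace ℝ (Fin d) → ℝ)
    (hφm : ∀ ξ, φm ξ = χ ξ - χ ((2 : ℝ) • ξ))
    (h : EuclideanSpace ℝ (Fin d) → ℂ) (hh : h = 𝓕⁻ fun ξ => (φm ξ : ℂ))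
    (htilde : EuclideanSpace ℝ (Fin d) → ℂ) (hht : htilde = 𝓕⁻ fun ξ => (χ ξ : ℂ)) :
    ∃ C > 0, ∀ f : SchwartzMap (EuclideanSpace ℝ (Fin d)) (Fin d → ℝ),
      (∀ x, ∑ k, pd (fun y => f y k) k x = 0) →
      (⨆ x, ‖fderiv ℝ (⇑f) x‖) ≤
        C * (Real.sqrt (∫ x, ∑ i, f x i ^ 2) +
          ((⨆ x, ‖fun i i' : Fin d => dblock htilde (curlMat (fun y => f y) i i') x‖) +
            ∑' j : ℕ, ⨆ x,
              ‖fun i i' : Fin d =>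
                dblock (fun y => (((2 : ℝ) ^ (j * d) : ℝ) : ℂ) * h ((2 : ℝ) ^ j • y))
                  (curlMat (fun y => f y) i i') x‖)) := by
  have hnorm : ∀ (c : ℝ) (ξ : EuclideanSpace ℝ (Fin d)), 0 ≤ c → ‖c • ξ‖ = c * ‖ξ‖ := by
    intro c ξ hc
    rw [norm_smul, Real.norm_of_nonneg hc]
  have h0 : ∀ ξ, 2 ≤ ‖ξ‖ → χ ξ = 0 := fun ξ hξ => by
    by_contra hne
    have := hχ_supp hne
    rw [mem_ball_zero_iff] at this
    linarith
  have h1 : ∀ ξ, ‖ξ‖ ≤ 1 → χ ξ = 1 := fun ξ hξ =>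
    subset_of_mem_nhdsSet hχ_one (mem_closedBall_zero_iff.2 hξ)
  have hcomp : HasCompactSupport χ :=
    HasCompactSupport.intro (isCompact_closedBall (0 : EuclideanSpace ℝ (Fin d)) 2) fun ξ hξ => by
      rw [mem_closedBall_zero_iff, not_le] at hξ
      exact h0 ξ hξ.le
  set X : SchwartzMap (EuclideanSpace ℝ (Fin d)) ℂ :=
    (hcomp.comp_left (g := Complex.ofReal) Complex.ofReal_zero).toSchwartzMap
      (Complex.ofRealCLM.contDiff.comp hχ_smooth) with hX
  have hXa : ∀ ξ, X ξ = (χ ξ : ℂ) := fun ξ => rfl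
  set X₂ := schwartzDilation (Units.mk0 2 two_ne_zero) X with hX₂
  set Φ := X - X₂ with hΦ
  have hΦX : ∀ ξ, Φ ξ = X ξ - X ((2 : ℝ) • ξ) := fun ξ => rfl
  have hΦa : ∀ ξ, Φ ξ = (φm ξ : ℂ) := fun ξ => by
    rw [hΦX, hXa, hXa, hφm, Complex.ofReal_sub]
  have hhΦ : h = 𝓕⁻ Φ := by
    rw [hh, SchwartzMap.fourierInv_coe]
    congr 1
    ext ξ
    rw [hΦa]
  have hX1 : ∀ ξ, ‖1 - X ξ‖ ≤ 2 * ‖ξ‖ := fun ξ => by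
    rw [hXa, ← Complex.ofReal_one, ← Complex.ofReal_sub, Complex.norm_real, Real.norm_eq_abs]
    rcases le_total ‖ξ‖ 1 with hξ | hξ
    · rw [h1 ξ hξ, sub_self, abs_zero]
      positivity
    · have := hχ_range ξ
      rw [abs_of_nonneg (by linarith [this.2])]
      linarith [this.1]
  have hΦ4 : ∀ ξ, ‖Φ ξ‖ ≤ 4 * ‖ξ‖ := fun ξ => by
    rw [hΦa, Complex.norm_real, Real.norm_eq_abs, hφm]
    rcases le_total ‖ξ‖ (1 / 2) with hξ | hξ
    · rw [h1 ξ (by linarith), h1 _ (by rw [hnorm _ _ (by norm_num)]; linarith), sub_self, abs_zero]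
      positivity
    · have h2 := hχ_range ((2 : ℝ) • ξ)
      rw [abs_le]
      constructor <;> linarith [(hχ_range ξ).1, (hχ_range ξ).2, h2.1, h2.2]
  have hΦs : ∀ η, Φ η ≠ 0 → 1 / 2 ≤ ‖η‖ ∧ ‖η‖ ≤ 2 := by
    intro η hη
    rw [hΦa, Complex.ofReal_ne_zero, hφm] at hη
    constructor
    · by_contra! hlt
      apply hη
      rw [h1 η (by linarith), h1 _ (by rw [hnorm _ _ (by norm_num)]; linarith), sub_self]
    · by_contra! hlt
      apply hη
      rw [h0 η hlt.le, h0 _ (by rw [hnorm _ _ (by norm_num)]; linarith), sub_self]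
  choose M hM using fun l m => exists_schwartz_eq_mul_div_norm_sq hχ_smooth h0 h1 l m
  set A : Fin d → ℝ := fun l => √(∫ y, ‖𝓕⁻ (𝓕 (∂_{EuclideanSpace.single l (1 : ℝ)} (𝓕⁻ X₂) :
    SchwartzMap (EuclideanSpace ℝ (Fin d)) ℂ)) y‖ ^ 2) with hA
  set B : Fin d → ℝ := fun l => ∑ m, ∫ y, ‖𝓕⁻ (M l m) y‖ with hB
  have hA0 : 0 ≤ ∑ l, A l := Finset.sum_nonneg fun l _ => Real.sqrt_nonneg _
  have hB0 : ∀ l, 0 ≤ B l := fun l =>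
    Finset.sum_nonneg fun m _ => integral_nonneg fun y => norm_nonneg _
  have hBs : 0 ≤ ∑ l, B l := Finset.sum_nonneg fun l _ => hB0 l
  refine ⟨∑ l, A l + ∑ l, B l + 1, by positivity, fun f hf => ?_⟩
  have : Nonempty (EuclideanSpace ℝ (Fin d)) := ⟨0⟩
  simp only [hhΦ, ← schwartzMultiplier_schwartzCurl_eq_dblock]
  set D := ⨆ x, ‖fun i i' : Fin d => dblock htilde (curlMat (fun y => f y) i i') x‖ with hD
  have hD0 : 0 ≤ D := Real.iSup_nonneg fun x => norm_nonneg _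
  set L := √(∫ x, ∑ i, f x i ^ 2) with hL
  have hL0 : 0 ≤ L := Real.sqrt_nonneg _
  set S : ℕ → ℝ := fun j => ⨆ x, ‖fun i i' : Fin d =>
    schwartzMultiplier (schwartzDilation (dyadicUnit j) Φ) (schwartzCurl f i i') x‖ with hS
  set K : ℝ := ∑ i, ∑ k, ∫ ξ, ‖ξ‖ * ‖𝓕 (schwartzCurl f i k) ξ‖ with hK
  have hK0 : ∀ i k, 0 ≤ ∫ ξ, ‖ξ‖ * ‖𝓕 (schwartzCurl f i k) ξ‖ := fun i k =>
    integral_nonneg fun ξ => by positivity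
  have hKle : ∀ i k, ∫ ξ, ‖ξ‖ * ‖𝓕 (schwartzCurl f i k) ξ‖ ≤ K := fun i k =>
    (Finset.single_le_sum (f := fun k => ∫ ξ, ‖ξ‖ * ‖𝓕 (schwartzCurl f i k) ξ‖)
      (fun k _ => hK0 i k) (Finset.mem_univ k)).trans
    (Finset.single_le_sum (f := fun i => ∑ k, ∫ ξ, ‖ξ‖ * ‖𝓕 (schwartzCurl f i k) ξ‖)
      (fun i _ => Finset.sum_nonneg fun k _ => hK0 i k) (Finset.mem_univ i))
  have hKnn : 0 ≤ K := Finset.sum_nonneg fun i _ => Finset.sum_nonneg fun k _ => hK0 i k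
  have hSb : ∀ j x, ‖fun i i' : Fin d =>
      schwartzMultiplier (schwartzDilation (dyadicUnit j) Φ) (schwartzCurl f i i') x‖ ≤
        4 * ((2 : ℝ) ^ j)⁻¹ * K := fun j x => by
    refine (pi_norm_le_iff_of_nonneg (by positivity)).2 fun i =>
      (pi_norm_le_iff_of_nonneg (by positivity)).2 fun k => ?_
    refine (norm_schwartzMultiplier_dyadic_le hΦ4 _ j x).trans ?_
    gcongr
    exact hKle i k
  have hS0 : ∀ j, 0 ≤ S j := fun j => Real.iSup_nonneg fun x => norm_nonneg _
  have hSsum : Summable S := by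
    refine Summable.of_nonneg_of_le hS0 (fun j => ciSup_le (hSb j)) ?_
    have : Summable fun j : ℕ => ((2 : ℝ) ^ j)⁻¹ := by
      simpa using summable_geometric_two
    exact (this.mul_left 4).mul_right K
  have hle : ∀ j i k x,
      ‖schwartzMultiplier (schwartzDilation (dyadicUnit j) Φ) (schwartzCurl f i k) x‖ ≤ S j := by
    intro j i k x
    refine le_trans ?_ (le_ciSup (f := fun x => ‖fun i i' : Fin d =>
      schwartzMultiplier (schwartzDilation (dyadicUnit j) Φ) (schwartzCurl f i i') x‖)
      ⟨_, Set.forall_mem_range.2 (hSb j)⟩ x)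
    exact (norm_le_pi_norm (fun i' : Fin d =>
      schwartzMultiplier (schwartzDilation (dyadicUnit j) Φ) (schwartzCurl f i i') x) k).trans
      (norm_le_pi_norm (fun i i' : Fin d =>
        schwartzMultiplier (schwartzDilation (dyadicUnit j) Φ) (schwartzCurl f i i') x) i)
  have hT0 : 0 ≤ ∑' j, S j := tsum_nonneg hS0
  have main : ∀ x l k, |pd (fun y => f y k) l x| ≤ A l * L + B l * ∑' j, S j := by
    intro x l k
    set G : SchwartzMap (EuclideanSpace ℝ (Fin d)) ℂ :=
      ∂_{EuclideanSpace.single l (1 : ℝ)} (schwartzComponent f k) with hG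
    have hlow : ‖schwartzMultiplier X₂ G x‖ ≤ A l * L := by
      rw [hG, schwartzMultiplier_lineDerivOp]
      refine (norm_schwartzMultiplier_le_L2 _ _ x).trans ?_
      gcongr
      exact sqrt_integral_norm_schwartzComponent_sq_le f k
    have hblock : ∀ j, ‖schwartzMultiplier (schwartzDilation (dyadicUnit j) Φ) G x‖ ≤
        B l * S j := by
      intro j
      rw [hG, schwartzMultiplier_lineDerivOp_eq_sum hΦs (hM l) f hf, sum_apply, hB, Finset.sum_mul]
      refine (norm_sum_le _ _).trans (Finset.sum_le_sum fun m _ => ?_)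
      refine (norm_schwartzMultiplier_le_of_bound _ _ (hle j m k) x).trans_eq ?_
      rw [integral_norm_fourierInv_schwartzDilation]
    have hN : ∀ N : ℕ, |pd (fun y => f y k) l x| ≤ A l * L + B l * ∑' j, S j +
        4 * ((2 : ℝ) ^ N)⁻¹ * ∫ ξ, ‖ξ‖ * ‖𝓕 G ξ‖ := by
      intro N
      have hr := norm_sub_sum_schwartzMultiplier_le hX1 hΦX G N x
      have hsum : ‖∑ j ∈ Finset.range N,
          schwartzMultiplier (schwartzDilation (dyadicUnit j) Φ) G x‖ ≤ B l * ∑' j, S j := by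
        refine (norm_sum_le _ _).trans ((Finset.sum_le_sum fun j _ => hblock j).trans ?_)
        rw [← Finset.mul_sum]
        exact mul_le_mul_of_nonneg_left (hSsum.sum_le_tsum _ fun j _ => hS0 j) (hB0 l)
      have hGx : |pd (fun y => f y k) l x| = ‖G x‖ := by
        rw [hG, lineDerivOp_schwartzComponent, Complex.norm_real, Real.norm_eq_abs]
      rw [hGx]
      set s := ∑ j ∈ Finset.range N, schwartzMultiplier (schwartzDilation (dyadicUnit j) Φ) G x
      calc ‖G x‖ = ‖schwartzMultiplier X₂ G x + s + (G x - schwartzMultiplier X₂ G x - s)‖ := by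
            congr 1
            ring
        _ ≤ _ := norm_add₃_le
        _ ≤ _ := by gcongr
    refine ge_of_tendsto' (x := Filter.atTop) ?_ hN
    have : Filter.Tendsto (fun N : ℕ => ((2 : ℝ) ^ N)⁻¹) Filter.atTop (𝓝 0) := by
      simpa using tendsto_pow_atTop_nhds_zero_of_lt_one (r := (2 : ℝ)⁻¹) (by norm_num) (by norm_num)
    simpa using ((this.const_mul 4).mul_const (∫ ξ, ‖ξ‖ * ‖𝓕 G ξ‖)).const_add
      (A l * L + B l * ∑' j, S j)
  refine ciSup_le fun x => (norm_fderiv_le_sum f x (main x)).trans ?_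
  rw [Finset.sum_add_distrib, ← Finset.sum_mul, ← Finset.sum_mul]
  nlinarith [mul_nonneg hA0 hD0, mul_nonneg hA0 hT0, mul_nonneg hBs hL0, mul_nonneg hBs hD0]
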